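/- arXiv:1510.08165 — 2 statements merged into one kernel-verified Lean document; each statement's English description precedes it below -/
import Mathlib

section
/- Let H be a real Hilbert space and C a nonempty closed convex subset of H. Let T_1,…,T_N : C → C be closed quasi-nonexpansive mappings with F = ⋂_{i=1}^N F(T_i) ≠ ∅. Let {α_n} ⊂ [0,1] with α_n → 0. Let {x_n} be generated by: x_0 ∈ C, C_0 = C; y_n^i = α_n x_0 + (1 − α_n) T_i x_n for i = 1,…,N; choose i_n ∈ {1,…,N} with ‖y_n^{i_n} − x_n‖ = max_{1≤i≤N} ‖y_n^i − x_n‖ and set ȳ_n = y_n^{i_n}; C_{n+1} = {v ∈ C_n : ‖v − ȳ_n‖² ≤ α_n‖v − x_0‖² + (1 − α_n)‖v − x_n‖²}; and x_{n+1} is the metric projection of x_0 onto C_{n+1}. Then {x_n} converges strongly to the metric projection of x_0 onto F. -/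
open Filter Topology

section HilbertLemmas

variable {H : Type*} [NormedAddCommGroup H] [InnerProductSpace ℝ H]

/-- Pythagorean inequality for a point of a convex set nearest to `u`. -/
lemma norm_sub_sq_le_of_nearest {K : Set H} (hK : Convex ℝ K) {u p v : H} (hp : p ∈ K)
    (hmin : ∀ w ∈ K, ‖p - u‖ ≤ ‖w - u‖) (hv : v ∈ K) :
    ‖v - p‖ ^ 2 ≤ ‖v - u‖ ^ 2 - ‖p - u‖ ^ 2 := by
  have : Nonempty K := ⟨⟨p, hp⟩⟩
  have hinf : ‖u - p‖ = ⨅ w : K, ‖u - w‖ := by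
    refine le_antisymm (le_ciInf fun w => ?_) (ciInf_le ⟨0, ?_⟩ (⟨p, hp⟩ : K))
    · simpa only [norm_sub_rev u] using hmin w w.2
    · rintro _ ⟨w, rfl⟩
      positivity
  have hinner := (norm_eq_iInf_iff_real_inner_le_zero hK hp).1 hinf v hv
  have hexp := norm_sub_sq_real (v - p) (u - p)
  rw [sub_sub_sub_cancel_right, real_inner_comm] at hexp
  rw [norm_sub_rev p u]
  linarith

/-- The quadratic terms cancel, so the set is a half-space. -/
lemma convex_setOf_norm_sub_sq_le (a : ℝ) (y b c : H) :
    Convex ℝ {v : H | ‖v - y‖ ^ 2 ≤ a * ‖v - b‖ ^ 2 + (1 - a) * ‖v - c‖ ^ 2} := by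
  have hset : {v : H | ‖v - y‖ ^ 2 ≤ a * ‖v - b‖ ^ 2 + (1 - a) * ‖v - c‖ ^ 2} =
      {v : H | innerSL ℝ (a • b + (1 - a) • c - y) v ≤
        (a * ‖b‖ ^ 2 + (1 - a) * ‖c‖ ^ 2 - ‖y‖ ^ 2) / 2} := by
    ext v
    simp only [Set.mem_ofPred_eq, norm_sub_sq_real, innerSL_apply_apply, inner_sub_left,
      inner_add_left, real_inner_smul_left, real_inner_comm v]
    constructor <;> intro h <;> linarith
  rw [hset]
  exact convex_halfSpace_le (innerSL ℝ (a • b + (1 - a) • c - y)).isLinear _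

lemma norm_sub_convex_combination_sq_le {a : ℝ} (ha : a ∈ Set.Icc (0 : ℝ) 1) (p b c : H) :
    ‖p - (a • b + (1 - a) • c)‖ ^ 2 ≤ a * ‖p - b‖ ^ 2 + (1 - a) * ‖p - c‖ ^ 2 := by
  have heq : p - (a • b + (1 - a) • c) = a • (p - b) + (1 - a) • (p - c) := by module
  have hconv := (convexOn_univ_norm (E := H)).pow (fun _ _ => norm_nonneg _) 2
  rw [heq]
  simpa using hconv.2 (Set.mem_univ (p - b)) (Set.mem_univ (p - c)) ha.1
    (sub_nonneg.2 ha.2) (add_sub_cancel a 1)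

/-- Nearest points to `u` in a decreasing sequence of convex sets converge when their
distances to `u` stay bounded. -/
lemma cauchySeq_of_nearest_antitone {K : ℕ → Set H} (hanti : Antitone K)
    (hconv : ∀ n, Convex ℝ (K n)) {x : ℕ → H} {u : H} (hx : ∀ n, x n ∈ K n)
    (hmin : ∀ n, ∀ v ∈ K n, ‖x n - u‖ ≤ ‖v - u‖) {R : ℝ} (hR : ∀ n, ‖x n - u‖ ≤ R) :
    CauchySeq x := by
  have hmono : Monotone fun n => ‖x n - u‖ ^ 2 := fun m n hmn =>
    pow_le_pow_left₀ (norm_nonneg _) (hmin m _ (hanti hmn (hx n))) 2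
  have hbdd : BddAbove (Set.range fun n => ‖x n - u‖ ^ 2) := by
    refine ⟨R ^ 2, ?_⟩
    rintro _ ⟨n, rfl⟩
    exact pow_le_pow_left₀ (norm_nonneg _) (hR n) 2
  have hcauchy := (tendsto_atTop_ciSup hmono hbdd).cauchySeq
  rw [Metric.cauchySeq_iff'] at hcauchy ⊢
  intro ε hε
  obtain ⟨m, hm⟩ := hcauchy (ε ^ 2) (by positivity)
  refine ⟨m, fun n hn => ?_⟩
  have hdist := hm n hn
  rw [Real.dist_eq] at hdist
  rw [dist_eq_norm]
  refine lt_of_pow_lt_pow_left₀ 2 hε.le ?_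
  calc ‖x n - x m‖ ^ 2 ≤ ‖x n - u‖ ^ 2 - ‖x m - u‖ ^ 2 :=
        norm_sub_sq_le_of_nearest (hconv m) (hx m) (hmin m) (hanti hn (hx n))
    _ ≤ |‖x n - u‖ ^ 2 - ‖x m - u‖ ^ 2| := le_abs_self _
    _ < ε ^ 2 := hdist

lemma tendsto_of_tendsto_convex_combination {α : ℕ → ℝ} (hα : Tendsto α atTop (𝓝 0))
    {b z : H} {w : ℕ → H}
    (h : Tendsto (fun n => α n • b + (1 - α n) • w n) atTop (𝓝 z)) :
    Tendsto w atTop (𝓝 z) := by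
  have hone : Tendsto (fun n => 1 - α n) atTop (𝓝 1) := by simpa using hα.const_sub 1
  have hlim := (hone.inv₀ one_ne_zero).smul (h.sub (hα.smul_const b))
  simp only [inv_one, one_smul, zero_smul, sub_zero, add_sub_cancel_left] at hlim
  refine hlim.congr' ?_
  filter_upwards [hone.eventually_ne one_ne_zero] with n hn
  rw [inv_smul_smul₀ hn]

end HilbertLemmas

/-- Modified parallel hybrid method for a finite family of closed quasi-nonexpansive
mappings in a real Hilbert space (Theorem 3.7, Hilbert-space form). -/
theorem stmt_4
    {H : Type*} [NormedAddCommGroup H] [InnerProductSpace ℝ H] [CompleteSpace H]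
    (C : Set H) (hCne : C.Nonempty) (hCcl : IsClosed C) (hCcv : Convex ℝ C)
    (N : ℕ) (hN : 0 < N) (T : Fin N → H → H) (hTmaps : ∀ i, Set.MapsTo (T i) C C)
    (hQN : ∀ i, ∀ p ∈ C, T i p = p → ∀ x ∈ C, ‖p - T i x‖ ≤ ‖p - x‖)
    (hTclosed : ∀ i, ∀ (u : ℕ → H) (p q : H), (∀ n, u n ∈ C) → p ∈ C →
      Tendsto u atTop (𝓝 p) → Tendsto (fun n => T i (u n)) atTop (𝓝 q) → T i p = q)
    (F : Set H) (hF : F = ⋂ i, {x ∈ C | T i x = x}) (hFne : F.Nonempty)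
    (α : ℕ → ℝ) (hα : ∀ n, α n ∈ Set.Icc (0 : ℝ) 1) (hαlim : Tendsto α atTop (𝓝 0))
    (x : ℕ → H) (y : ℕ → Fin N → H) (i_ : ℕ → Fin N) (CS : ℕ → Set H)
    (hx0 : x 0 ∈ C) (hCS0 : CS 0 = C)
    (hy : ∀ n i, y n i = α n • x 0 + (1 - α n) • T i (x n))
    (hmax : ∀ n i, ‖y n i - x n‖ ≤ ‖y n (i_ n) - x n‖)
    (hCS : ∀ n, CS (n + 1) =
      {v ∈ CS n | ‖v - y n (i_ n)‖ ^ 2 ≤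
        α n * ‖v - x 0‖ ^ 2 + (1 - α n) * ‖v - x n‖ ^ 2})
    (hproj : ∀ n, x (n + 1) ∈ CS (n + 1) ∧
      ∀ v ∈ CS (n + 1), ‖x (n + 1) - x 0‖ ≤ ‖v - x 0‖) :
    ∃ z ∈ F, (∀ v ∈ F, ‖z - x 0‖ ≤ ‖v - x 0‖) ∧ Tendsto x atTop (𝓝 z) := by
  have hanti : Antitone CS := antitone_nat_of_succ_le fun n => by
    rw [hCS n]
    exact Set.sep_subset _ _
  have hconv : ∀ n, Convex ℝ (CS n) := by
    intro n
    induction n with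
    | zero => rwa [hCS0]
    | succ n ih =>
      rw [hCS n]
      exact ih.inter (convex_setOf_norm_sub_sq_le _ _ _ _)
  have hxCS : ∀ n, x n ∈ CS n
    | 0 => by rwa [hCS0]
    | n + 1 => (hproj n).1
  have hmin : ∀ n, ∀ v ∈ CS n, ‖x n - x 0‖ ≤ ‖v - x 0‖
    | 0 => fun v _ => by simp
    | n + 1 => (hproj n).2
  have hxC : ∀ n, x n ∈ C := fun n => hCS0 ▸ hanti (Nat.zero_le n) (hxCS n)
  have hmemF : ∀ v, v ∈ F ↔ ∀ i, v ∈ C ∧ T i v = v := fun v => by simp [hF]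
  have hFCS : ∀ n, F ⊆ CS n := by
    intro n
    induction n with
    | zero =>
      intro v hv
      rw [hCS0]
      exact ((hmemF v).1 hv ⟨0, hN⟩).1
    | succ n ih =>
      intro v hv
      rw [hCS n]
      refine ⟨ih hv, ?_⟩
      obtain ⟨hvC, hvT⟩ := (hmemF v).1 hv (i_ n)
      rw [hy]
      refine (norm_sub_convex_combination_sq_le (hα n) _ _ _).trans ?_
      have := sub_nonneg.2 (hα n).2
      gcongr
      exact hQN _ v hvC hvT _ (hxC n)
  obtain ⟨p, hp⟩ := hFne
  obtain ⟨z, hz⟩ := cauchySeq_tendsto_of_complete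
    (cauchySeq_of_nearest_antitone hanti hconv hxCS hmin fun n => hmin n p (hFCS n hp))
  have hzC : z ∈ C := hCcl.mem_of_tendsto hz (Eventually.of_forall hxC)
  have hz' := hz.comp (tendsto_add_atTop_nat 1)
  have hbound : Tendsto (fun n => α n * ‖x (n + 1) - x 0‖ ^ 2 +
      (1 - α n) * ‖x (n + 1) - x n‖ ^ 2) atTop (𝓝 0) := by
    simpa using (hαlim.mul ((hz'.sub_const (x 0)).norm.pow 2)).add
      ((hαlim.const_sub 1).mul ((hz'.sub hz).norm.pow 2))
  have hsq : Tendsto (fun n => ‖x (n + 1) - y n (i_ n)‖ ^ 2) atTop (𝓝 0) := by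
    refine squeeze_zero (fun n => by positivity) (fun n => ?_) hbound
    have := hxCS (n + 1)
    rw [hCS n] at this
    exact this.2
  have hdiff : Tendsto (fun n => x (n + 1) - y n (i_ n)) atTop (𝓝 0) := by
    rw [tendsto_zero_iff_norm_tendsto_zero]
    simpa [Real.sqrt_sq] using hsq.sqrt
  have hgap : Tendsto (fun n => ‖y n (i_ n) - x n‖) atTop (𝓝 0) := by
    simpa using ((hz'.sub hz).sub hdiff).norm
  have hyz : ∀ i, Tendsto (fun n => y n i) atTop (𝓝 z) := by
    intro i
    have hyx : Tendsto (fun n => y n i - x n) atTop (𝓝 0) :=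
      squeeze_zero_norm (fun n => hmax n i) hgap
    simpa using hyx.add hz
  refine ⟨z, (hmemF z).2 fun i => ⟨hzC, hTclosed i x z z hxC hzC hz ?_⟩, fun v hv => ?_, hz⟩
  · have hyi := hyz i
    simp only [hy] at hyi
    exact tendsto_of_tendsto_convex_combination hαlim hyi
  · exact le_of_tendsto (hz.sub_const (x 0)).norm
      (Eventually.of_forall fun n => hmin n v (hFCS n hv))
end

section
/- Let E be a real Banach space, C ⊆ E, and let T_1,…,T_N : C → C be uniformly L-Lipschitz mappings (L > 0). For n ≥ 1 write n = (p_n − 1)N + j_n with j_n ∈ {1,…,N} (i.e. j_n = ((n−1) mod N) + 1 and p_n = ⌊(n−1)/N⌋ + 1), so that for n > N one has p_n − 1 = p_{n−N} and j_n = j_{n−N}. Then for any sequence {x_n} ⊂ C and any n > N: ‖x_n − T_{j_n} x_n‖ ≤ ‖x_n − T_{j_n}^{p_n} x_n‖ + L‖T_{j_{n−N}}^{p_{n−N}} x_{n−N} − x_{n−N}‖ + (L² + L)‖x_{n−N} − x_n‖. -/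
/-- If `S` and its iterate `S^[m]` are `L`-Lipschitz on an `S`-invariant set, then the displacement
of `S` at `u` is controlled by that of `S^[m + 1]` at `u` and that of `S^[m]` at `v`. -/
theorem norm_sub_apply_le_of_iterate_lipschitz {E : Type*} [SeminormedAddCommGroup E] {C : Set E}
    {S : E → E} (hS : Set.MapsTo S C C) {L : ℝ} (hL : 0 ≤ L) {m : ℕ}
    (hLip : ∀ x ∈ C, ∀ y ∈ C, ‖S x - S y‖ ≤ L * ‖x - y‖)
    (hLipm : ∀ x ∈ C, ∀ y ∈ C, ‖S^[m] x - S^[m] y‖ ≤ L * ‖x - y‖)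
    {u v : E} (hu : u ∈ C) (hv : v ∈ C) :
    ‖u - S u‖ ≤ ‖u - S^[m + 1] u‖ + L * ‖S^[m] v - v‖ + (L ^ 2 + L) * ‖v - u‖ := by
  have hm : ‖S^[m] u - u‖ ≤ L * ‖v - u‖ + ‖S^[m] v - v‖ + ‖v - u‖ :=
    calc ‖S^[m] u - u‖ ≤ ‖S^[m] u - S^[m] v‖ + ‖S^[m] v - u‖ := norm_sub_le_norm_sub_add_norm_sub ..
      _ ≤ L * ‖v - u‖ + (‖S^[m] v - v‖ + ‖v - u‖) :=
        add_le_add ((hLipm u hu v hv).trans_eq (by rw [norm_sub_rev]))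
          (norm_sub_le_norm_sub_add_norm_sub ..)
      _ = _ := (add_assoc ..).symm
  calc ‖u - S u‖ ≤ ‖u - S^[m + 1] u‖ + ‖S^[m + 1] u - S u‖ := norm_sub_le_norm_sub_add_norm_sub ..
    _ ≤ ‖u - S^[m + 1] u‖ + L * ‖S^[m] u - u‖ := by
      rw [Function.iterate_succ_apply']
      gcongr
      exact hLip _ (hS.iterate m hu) _ hu
    _ ≤ ‖u - S^[m + 1] u‖ + L * (L * ‖v - u‖ + ‖S^[m] v - v‖ + ‖v - u‖) := by gcongr
    _ = _ := by ring

/-- The key estimate in the proof of Lemma 3.13: for `n > N`,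
`‖xₙ - T_{jₙ} xₙ‖ ≤ ‖xₙ - T_{jₙ}^{pₙ} xₙ‖ + L ‖T_{j_{n-N}}^{p_{n-N}} x_{n-N} - x_{n-N}‖
 + (L² + L) ‖x_{n-N} - xₙ‖`, where `jₙ = ((n-1) % N) + 1` and `pₙ = (n-1)/N + 1`. -/
theorem stmt_9
    {E : Type*} [NormedAddCommGroup E] [NormedSpace ℝ E]
    (C : Set E) (N : ℕ) (hN : 0 < N)
    (T : Fin N → E → E) (hTmaps : ∀ i, Set.MapsTo (T i) C C)
    (L : ℝ) (hL : 0 < L)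
    (hLip : ∀ i, ∀ n, 1 ≤ n → ∀ x ∈ C, ∀ y ∈ C,
      ‖(T i)^[n] x - (T i)^[n] y‖ ≤ L * ‖x - y‖)
    (x : ℕ → E) (hx : ∀ n, x n ∈ C)
    (n : ℕ) (hn : N < n) :
    ‖x n - T ⟨(n - 1) % N, Nat.mod_lt _ hN⟩ (x n)‖ ≤
      ‖x n - (T ⟨(n - 1) % N, Nat.mod_lt _ hN⟩)^[(n - 1) / N + 1] (x n)‖ +
      L * ‖(T ⟨(n - N - 1) % N, Nat.mod_lt _ hN⟩)^[(n - N - 1) / N + 1] (x (n - N)) -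
        x (n - N)‖ +
      (L ^ 2 + L) * ‖x (n - N) - x n‖ := by
  obtain ⟨k, rfl⟩ : ∃ k, n = k + 1 + N := ⟨n - 1 - N, by omega⟩
  have hsub : k + 1 + N - 1 = k + N := by omega
  simp only [Nat.add_sub_cancel, hsub, Nat.add_mod_right, Nat.add_div_right k hN]
  exact norm_sub_apply_le_of_iterate_lipschitz (hTmaps _) hL.le (hLip _ 1 le_rfl)
    (hLip _ _ (Nat.le_add_left 1 _)) (hx _) (hx _)
end
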